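/- arXiv:2201.00609 — 9 statements merged into one kernel-verified Lean document; each statement's English description precedes it below -/
import Mathlib

section
/- Let (v_n)_{n≥0} be a real sequence and let n ≥ 3. Define G₃[a,b] := (37/96)a² − (1/8)b² + (7/24)(a−b)². Then the discrete gradient structure identity holds: v_n·(b₀^{(3)}v_n + b₁^{(3)}v_{n−1} + b₂^{(3)}v_{n−2}) = G₃[v_n, v_{n−1}] − G₃[v_{n−1}, v_{n−2}] + (95/96)v_n² + (1/6)(δ₁²v_n + (1/4)v_{n−1})². Moreover G₃ is nonnegative: G₃[a,b] = (1/6)a² + (1/6)((7/4)a − b)² ≥ 0 for all real a, b. -/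
noncomputable def bdf3 : ℕ → ℝ
  | 0 => 11/6
  | 1 => -(7/6)
  | 2 => 1/3
  | _ => 0

/-- Backward difference operators: `delta v 0 n = v n`,
`delta v (m+1) n = delta v m n - delta v m (n-1)`. -/
noncomputable def delta (v : ℕ → ℝ) : ℕ → ℕ → ℝ
  | 0, n => v n
  | m+1, n => delta v m n - delta v m (n-1)

/-- `G₃[a,b] = (37/96)a² − (1/8)b² + (7/24)(a−b)²`. -/
noncomputable def G3 (a b : ℝ) : ℝ := 37/96 * a^2 - 1/8 * b^2 + 7/24 * (a - b)^2

theorem bdf3_discrete_gradient_structure (v : ℕ → ℝ) (n : ℕ) (hn : 3 ≤ n) :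
    (v n * (bdf3 0 * v n + bdf3 1 * v (n-1) + bdf3 2 * v (n-2)) =
      G3 (v n) (v (n-1)) - G3 (v (n-1)) (v (n-2)) + 95/96 * (v n)^2
        + 1/6 * (delta v 2 n + 1/4 * v (n-1))^2) ∧
    ∀ a b : ℝ, G3 a b = 1/6 * a^2 + 1/6 * (7/4 * a - b)^2 ∧ 0 ≤ G3 a b := by
  have G3_eq (a b : ℝ) : G3 a b = 1/6 * a^2 + 1/6 * (7/4 * a - b)^2 := by
    simp only [G3]
    ring
  refine ⟨?_, fun a b => ⟨G3_eq a b, by rw [G3_eq]; positivity⟩⟩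
  have sub_one_sub_one : n - 1 - 1 = n - 2 := by omega
  simp only [G3, delta, bdf3, sub_one_sub_one]
  ring
end

section
/- For every m ≥ 1 and all real numbers v₁, …, v_m, the quadratic form generated by the BDF-3 kernels satisfies 2·∑_{ℓ=1}^{m} v_ℓ · ∑_{j=1}^{ℓ} b_{ℓ−j}^{(3)} v_j ≥ (95/48)·∑_{ℓ=1}^{m} v_ℓ². -/
theorem bdf3_convolution (v : ℕ → ℝ) (h0 : v 0 = 0) (n : ℕ) :
    ∑ j ∈ Finset.Icc 1 (n + 2), bdf3 (n + 2 - j) * v j =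
      11/6 * v (n + 2) - 7/6 * v (n + 1) + 1/3 * v n := by
  rcases n with _ | k
  · simp [Finset.sum_Icc_succ_top, bdf3, h0]
    ring
  · have hz : ∑ j ∈ Finset.Icc 1 k, bdf3 (k + 1 + 2 - j) * v j = 0 := by
      refine Finset.sum_eq_zero fun j hj => ?_
      obtain ⟨i, rfl⟩ := Nat.exists_eq_add_of_le (Finset.mem_Icc.mp hj).2
      rw [show j + i + 1 + 2 - j = i + 3 by omega]
      simp [bdf3]
    rw [Finset.sum_Icc_succ_top (by omega), Finset.sum_Icc_succ_top (by omega),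
      Finset.sum_Icc_succ_top (by omega), hz,
      show k + 1 + 2 - (k + 1) = 2 by omega, show k + 1 + 2 - (k + 1 + 1) = 1 by omega,
      Nat.sub_self]
    simp only [bdf3]
    ring

theorem bdf3_form_lower_bound (v : ℕ → ℝ) (h0 : v 0 = 0) (n : ℕ) :
    95/48 * ∑ l ∈ Finset.Icc 1 (n + 1), (v l)^2 +
        1/3 * ((v n - 7/4 * v (n + 1))^2 + (v (n + 1))^2) ≤
      2 * ∑ l ∈ Finset.Icc 1 (n + 1), v l * ∑ j ∈ Finset.Icc 1 l, bdf3 (l - j) * v j := by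
  induction n with
  | zero =>
    simp [bdf3, h0]
    nlinarith [sq_nonneg (v 1)]
  | succ n ih =>
    rw [Finset.sum_Icc_succ_top (b := n + 1) (by omega),
      Finset.sum_Icc_succ_top (b := n + 1) (by omega), bdf3_convolution v h0 n]
    linear_combination ih + 1/3 * sq_nonneg (v (n + 2) - 7/4 * v (n + 1) + v n)

theorem bdf3_kernels_positive_definite (m : ℕ) (hm : 1 ≤ m) (v : ℕ → ℝ) :
    95/48 * ∑ ℓ ∈ Finset.Icc 1 m, (v ℓ)^2 ≤
      2 * ∑ ℓ ∈ Finset.Icc 1 m, v ℓ * ∑ j ∈ Finset.Icc 1 ℓ, bdf3 (ℓ - j) * v j := by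
  obtain ⟨n, rfl⟩ := Nat.exists_eq_add_of_le' hm
  have hu : ∀ l, 1 ≤ l → Function.update v 0 0 l = v l := fun l hl =>
    Function.update_of_ne (by omega) _ _
  have key := bdf3_form_lower_bound (Function.update v 0 0) (Function.update_self _ _ _) n
  have hsq : ∑ l ∈ Finset.Icc 1 (n + 1), (Function.update v 0 0 l)^2 =
      ∑ l ∈ Finset.Icc 1 (n + 1), (v l)^2 :=
    Finset.sum_congr rfl fun l hl => by rw [hu l (Finset.mem_Icc.mp hl).1]
  have hform : ∑ l ∈ Finset.Icc 1 (n + 1), Function.update v 0 0 l *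
        ∑ j ∈ Finset.Icc 1 l, bdf3 (l - j) * Function.update v 0 0 j =
      ∑ l ∈ Finset.Icc 1 (n + 1), v l * ∑ j ∈ Finset.Icc 1 l, bdf3 (l - j) * v j :=
    Finset.sum_congr rfl fun l hl => by
      rw [hu l (Finset.mem_Icc.mp hl).1]
      congr 1
      exact Finset.sum_congr rfl fun j hj => by rw [hu j (Finset.mem_Icc.mp hj).1]
  rw [hsq, hform] at key
  exact le_trans (le_add_of_nonneg_right (by positivity)) key
end

section
/- Let (v_n)_{n≥0} be a real sequence and let n ≥ 4. Define G₄[a,b,c] := (3433/6144)a² − (15/64)b² + (1/8)c² + (47/192)(a−b)² − (3/16)(b−c)² + (3/16)(a−2b+c)². Then the discrete gradient structure identity holds: v_n·∑_{j=0}^{3} b_j^{(4)} v_{n−j} = G₄[v_n, v_{n−1}, v_{n−2}] − G₄[v_{n−1}, v_{n−2}, v_{n−3}] + (4919/6144)v_n² + (1/8)(δ₁³v_n + (3/2)δ₁v_{n−1})² + (1/6)(δ₁²v_n + (35/32)v_{n−1})². Moreover G₄ is nonnegative: G₄[a,b,c] = (13627/43008)a² + (7/24)((65/56)a − b)² + (1/8)((3/2)(a−b)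 + c)² ≥ 0 for all real a, b, c. -/
noncomputable def bdf4 : ℕ → ℝ
  | 0 => 25/12
  | 1 => -(23/12)
  | 2 => 13/12
  | 3 => -(1/4)
  | _ => 0

/-- `G₄[a,b,c]`. -/
noncomputable def G4 (a b c : ℝ) : ℝ :=
  3433/6144 * a^2 - 15/64 * b^2 + 1/8 * c^2 + 47/192 * (a - b)^2
    - 3/16 * (b - c)^2 + 3/16 * (a - 2*b + c)^2

theorem bdf4_discrete_gradient_structure (v : ℕ → ℝ) (n : ℕ) (hn : 4 ≤ n) :
    (v n * ∑ j ∈ Finset.range 4, bdf4 j * v (n - j) =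
      G4 (v n) (v (n-1)) (v (n-2)) - G4 (v (n-1)) (v (n-2)) (v (n-3))
        + 4919/6144 * (v n)^2
        + 1/8 * (delta v 3 n + 3/2 * delta v 1 (n-1))^2
        + 1/6 * (delta v 2 n + 35/32 * v (n-1))^2) ∧
    ∀ a b c : ℝ, G4 a b c =
        13627/43008 * a^2 + 7/24 * (65/56 * a - b)^2 + 1/8 * (3/2 * (a - b) + c)^2
      ∧ 0 ≤ G4 a b c := by
  obtain ⟨m, rfl⟩ := Nat.exists_eq_add_of_le' hn
  refine ⟨?_, fun a b c => ?_⟩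
  · simp only [Finset.sum_range_succ, Finset.sum_range_zero, bdf4, delta, G4,
      Nat.reduceSubDiff, Nat.sub_zero]
    ring
  · have h : G4 a b c =
        13627/43008 * a^2 + 7/24 * (65/56 * a - b)^2 + 1/8 * (3/2 * (a - b) + c)^2 := by
      unfold G4
      ring
    exact ⟨h, h ▸ by positivity⟩
end

section
/- For every m ≥ 1 and all real numbers v₁, …, v_m, the quadratic form generated by the BDF-4 kernels satisfies 2·∑_{ℓ=1}^{m} v_ℓ · ∑_{j=1}^{ℓ} b_{ℓ−j}^{(4)} v_j ≥ (4919/3072)·∑_{ℓ=1}^{m} v_ℓ². -/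
theorem sum_bdf4_mul (u : ℕ → ℝ) (h0 : u 0 = 0) (h1 : u 1 = 0) (h2 : u 2 = 0) (n : ℕ) :
    ∑ i ∈ Finset.range (n + 1), bdf4 (n - i) * u (i + 3) =
      25/12 * u (n + 3) - 23/12 * u (n + 2) + 13/12 * u (n + 1) - 1/4 * u n := by
  match n with
  | 0 => simp [bdf4, h0, h1, h2]
  | 1 => simp [Finset.sum_range_succ, bdf4, h1, h2]; ring
  | 2 => simp [Finset.sum_range_succ, bdf4, h2]; ring
  | k + 3 =>
    have hz : ∑ i ∈ Finset.range k, bdf4 (k + 3 - i) * u (i + 3) = 0 := by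
      refine Finset.sum_eq_zero fun i hi => ?_
      obtain ⟨d, rfl⟩ := Nat.exists_eq_add_of_lt (Finset.mem_range.mp hi)
      rw [show i + d + 1 + 3 - i = d + 4 by omega]
      simp [bdf4]
    have e1 : k + 3 - (k + 1) = 2 := by omega
    have e2 : k + 3 - (k + 2) = 1 := by omega
    rw [Finset.sum_range_succ, Finset.sum_range_succ, Finset.sum_range_succ,
      Finset.sum_range_succ, hz, e1, e2, Nat.sub_self, Nat.add_sub_cancel_left]
    simp only [bdf4]
    ring

/-- A storage function for the BDF-4 quadratic form, obtained from the factorization of its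
symbol into `1/4 * |(1 - z) * (z^2 - 3/4 * z + 1)|^2 + 5/24 * |z^2 - 53/80 * z + 1|^2` plus a
positive constant. -/
noncomputable def bdf4Storage (x y z : ℝ) : ℝ :=
  1/4 * ((7/4 * x - 7/4 * y + z)^2 + (7/4 * x - y)^2 + x^2)
    + 5/24 * ((y - 53/80 * x)^2 + x^2)

theorem bdf4Storage_nonneg (x y z : ℝ) : 0 ≤ bdf4Storage x y z := by
  unfold bdf4Storage
  positivity

theorem bdf4Storage_le_add (x y z w : ℝ) :
    bdf4Storage x y z + 4919/3072 * x^2 ≤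
      bdf4Storage y z w + 2 * (x * (25/12 * x - 23/12 * y + 13/12 * z - 1/4 * w)) := by
  unfold bdf4Storage
  nlinarith [sq_nonneg (x - 7/4 * y + 7/4 * z - w), sq_nonneg (x - 53/80 * y + z), sq_nonneg x]

theorem bdf4Storage_le_sum (u : ℕ → ℝ) (h0 : u 0 = 0) (h1 : u 1 = 0) (h2 : u 2 = 0) (m : ℕ) :
    bdf4Storage (u (m + 2)) (u (m + 1)) (u m) +
        4919/3072 * ∑ n ∈ Finset.range m, u (n + 3)^2 ≤
      2 * ∑ n ∈ Finset.range m,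
        u (n + 3) * ∑ i ∈ Finset.range (n + 1), bdf4 (n - i) * u (i + 3) := by
  induction m with
  | zero => simp [bdf4Storage, h0, h1, h2]
  | succ m ih =>
    rw [Finset.sum_range_succ, Finset.sum_range_succ, sum_bdf4_mul u h0 h1 h2 m,
      show m + 1 + 2 = m + 3 from rfl, show m + 1 + 1 = m + 2 from rfl]
    linarith [bdf4Storage_le_add (u (m + 3)) (u (m + 2)) (u (m + 1)) (u m)]

theorem sum_Icc_one_eq_sum_range (f : ℕ → ℝ) (m : ℕ) :
    ∑ ℓ ∈ Finset.Icc 1 m, f ℓ = ∑ n ∈ Finset.range m, f (n + 1) := by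
  rw [Finset.range_eq_Ico, Finset.sum_Ico_add' f 0 m 1]
  rfl

theorem bdf4_kernels_positive_definite (m : ℕ) (hm : 1 ≤ m) (v : ℕ → ℝ) :
    4919/3072 * ∑ ℓ ∈ Finset.Icc 1 m, (v ℓ)^2 ≤
      2 * ∑ ℓ ∈ Finset.Icc 1 m, v ℓ * ∑ j ∈ Finset.Icc 1 ℓ, bdf4 (ℓ - j) * v j := by
  have h := bdf4Storage_le_sum (fun n => if n < 3 then 0 else v (n - 2))
    (by simp) (by simp) (by simp) m
  simp only [sum_Icc_one_eq_sum_range, Nat.add_sub_add_right]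
  simp only [Nat.not_lt.mpr (Nat.le_add_left 3 _), if_false,
    show ∀ n, n + 3 - 2 = n + 1 from fun _ => rfl] at h
  exact (le_add_of_nonneg_left (bdf4Storage_nonneg _ _ _)).trans h
end

section
/- Let (θ_j^{(3)})_{j≥0} be the DOC kernels associated with the BDF-3 kernels. Then the decaying estimate |θ_j^{(3)}| ≤ (5/6)·(3/7)^j holds for all j ≥ 0. -/
/-- The DOC kernels associated with kernels `b`:
`θ₀ = 1/b₀` and `θ_j = -(1/b₀) * ∑_{s=1}^{j} θ_{j-s} b_s` for `j ≥ 1`. -/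
noncomputable def doc (b : ℕ → ℝ) : ℕ → ℝ
  | 0 => 1 / b 0
  | j+1 => -(1 / b 0) * ∑ s ∈ (Finset.Icc 1 (j+1)).attach, doc b ((j+1) - s.1) * b s.1
  decreasing_by
    have h := Finset.mem_Icc.mp s.2
    omega

theorem doc_succ (b : ℕ → ℝ) (j : ℕ) :
    doc b (j + 1) = -(1 / b 0) * ∑ s ∈ Finset.range (j + 1), doc b (j - s) * b (s + 1) := by
  rw [doc, Finset.sum_attach (Finset.Icc 1 (j + 1)) (fun s => doc b (j + 1 - s) * b s),
    ← Finset.Ico_add_one_right_eq_Icc, Finset.sum_Ico_eq_sum_range]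
  congr 1
  refine Finset.sum_congr (by simp) fun s _ => ?_
  rw [add_comm 1 s, Nat.add_sub_add_right]

theorem doc_bdf3_zero : doc bdf3 0 = 6 / 11 := by
  norm_num [doc, bdf3]

theorem doc_bdf3_one : doc bdf3 1 = 42 / 121 := by
  rw [doc_succ]
  norm_num [doc_bdf3_zero, bdf3]

theorem doc_bdf3_add_two (j : ℕ) :
    doc bdf3 (j + 2) = 7 / 11 * doc bdf3 (j + 1) - 2 / 11 * doc bdf3 j := by
  rw [doc_succ, Finset.sum_range_succ', Finset.sum_range_succ']
  have h : ∑ s ∈ Finset.range j, doc bdf3 (j + 1 - (s + 1 + 1)) * bdf3 (s + 1 + 1 + 1) = 0 :=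
    Finset.sum_eq_zero fun s _ => by simp [bdf3]
  rw [h]
  simp only [bdf3, zero_add, Nat.add_sub_cancel, Nat.sub_zero]
  ring

/-- The quadratic form attached to the characteristic polynomial of the recurrence is
multiplied by the product `2 / 11` of the characteristic roots at each step. -/
theorem doc_bdf3_quadratic_form (j : ℕ) :
    doc bdf3 (j + 1) ^ 2 - 7 / 11 * doc bdf3 (j + 1) * doc bdf3 j + 2 / 11 * doc bdf3 j ^ 2 =
      72 / 1331 * (2 / 11) ^ j := by
  induction j with
  | zero => norm_num [doc_bdf3_zero, doc_bdf3_one]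
  | succ j ih =>
    rw [doc_bdf3_add_two, pow_succ (2 / 11 : ℝ) j]
    linear_combination 2 / 11 * ih

theorem doc_bdf3_decay (j : ℕ) : |doc bdf3 j| ≤ 5/6 * (3/7)^j := by
  refine abs_le_of_sq_le_sq ?_ (by positivity)
  have hpow : (2 / 11 : ℝ) ^ j ≤ ((3 / 7) ^ j) ^ 2 := by
    rw [← pow_mul, mul_comm, pow_mul]
    gcongr
    norm_num
  have hpos : (0 : ℝ) < (2 / 11) ^ j := by positivity
  rw [mul_pow]
  nlinarith [doc_bdf3_quadratic_form j, sq_nonneg (doc bdf3 (j + 1) - 7 / 22 * doc bdf3 j)]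
end

section
/- Let (θ_j^{(4)})_{j≥0} be the DOC kernels associated with the BDF-4 kernels. Then the decaying estimate |θ_j^{(4)}| ≤ (3/2)·(4/7)^j holds for all j ≥ 0. -/
theorem doc_bdf4_add_three (j : ℕ) :
    doc bdf4 (j + 3) = 23 / 25 * doc bdf4 (j + 2) - 13 / 25 * doc bdf4 (j + 1)
      + 3 / 25 * doc bdf4 j := by
  rw [doc_succ, Finset.sum_range_succ', Finset.sum_range_succ', Finset.sum_range_succ']
  simp [bdf4]
  ring

theorem doc_bdf4_zero : doc bdf4 0 = 12 / 25 := by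
  norm_num [doc, bdf4]

theorem doc_bdf4_one : doc bdf4 1 = 276 / 625 := by
  rw [doc_succ]
  norm_num [doc_bdf4_zero, bdf4]

theorem doc_bdf4_two : doc bdf4 2 = 2448 / 15625 := by
  rw [doc_succ]
  norm_num [Finset.sum_range_succ, doc_bdf4_zero, doc_bdf4_one, bdf4]

/-- A quadratic Lyapunov function for the recurrence satisfied by `doc bdf4 j * (7 / 4) ^ j`. -/
def bdf4Lyapunov (x y z : ℝ) : ℝ :=
  26 * x ^ 2 + 116 * y ^ 2 + 60 * z ^ 2 - 98 * (x * y) + 40 * (x * z) - 132 * (y * z)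

theorem bdf4Lyapunov_step_le (x y z : ℝ) :
    bdf4Lyapunov y z (161 / 100 * z - 637 / 400 * y + 1029 / 1600 * x) ≤ bdf4Lyapunov x y z := by
  unfold bdf4Lyapunov
  nlinarith [sq_nonneg (x - 7 / 20 * y + 27 / 100 * z), sq_nonneg (y - 1 / 4 * z), sq_nonneg x,
    sq_nonneg y, sq_nonneg z]

theorem mul_sq_le_bdf4Lyapunov (x y z : ℝ) : 10 * z ^ 2 ≤ bdf4Lyapunov x y z := by
  unfold bdf4Lyapunov
  nlinarith [sq_nonneg (26 * x - 49 * y + 20 * z), sq_nonneg (615 * y - 736 * z), sq_nonneg z]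

theorem bdf4Lyapunov_doc_le (j : ℕ) :
    bdf4Lyapunov (doc bdf4 j * (7 / 4) ^ j) (doc bdf4 (j + 1) * (7 / 4) ^ (j + 1))
      (doc bdf4 (j + 2) * (7 / 4) ^ (j + 2)) ≤ 45 / 2 := by
  induction j with
  | zero => norm_num [bdf4Lyapunov, doc_bdf4_zero, doc_bdf4_one, doc_bdf4_two]
  | succ j ih =>
    refine le_trans (le_of_eq ?_) ((bdf4Lyapunov_step_le _ _ _).trans ih)
    congr 1
    rw [show j + 1 + 2 = j + 3 by rfl, doc_bdf4_add_three]
    ring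

theorem doc_bdf4_decay (j : ℕ) : |doc bdf4 j| ≤ 3/2 * (4/7)^j := by
  match j with
  | 0 => norm_num [doc_bdf4_zero, abs_le]
  | 1 => norm_num [doc_bdf4_one, abs_le]
  | j + 2 =>
    have h : |doc bdf4 (j + 2) * (7 / 4) ^ (j + 2)| ≤ 3 / 2 := by
      apply abs_le_of_sq_le_sq _ (by norm_num)
      linarith [(mul_sq_le_bdf4Lyapunov _ _ _).trans (bdf4Lyapunov_doc_le j)]
    rw [abs_mul, abs_of_pos (by positivity : (0 : ℝ) < (7 / 4) ^ (j + 2))] at h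
    calc |doc bdf4 (j + 2)|
        = |doc bdf4 (j + 2)| * (7 / 4) ^ (j + 2) * (4 / 7) ^ (j + 2) := by
          rw [mul_assoc, ← mul_pow]; norm_num
      _ ≤ 3 / 2 * (4 / 7) ^ (j + 2) := by gcongr
end

section
/- Let (b_j)_{j≥0} be real kernels with b₀ ≠ 0, let (θ_j)_{j≥0} be the associated DOC kernels, and let m ≥ 1 be an integer. Then the kernels b are positive definite if and only if the kernels θ are positive definite; that is, (for all real v₁, …, v_m not all zero, ∑_{ℓ=1}^{m} v_ℓ · ∑_{j=1}^{ℓ} b_{ℓ−j} v_j > 0) if and only if (for all real v₁, …, v_m not all zero, ∑_{ℓ=1}^{m} v_ℓ · ∑_{j=1}^{ℓ} θ_{ℓ−j} v_j > 0). -/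
open PowerSeries in
lemma coeff_mk_mul_mk_ite (d v : ℕ → ℝ) (n : ℕ) :
    coeff n (mk d * mk fun k => if k = 0 then 0 else v k) =
      ∑ j ∈ Finset.Icc 1 n, d (n - j) * v j := by
  rw [mul_comm, coeff_mul, Finset.Nat.sum_antidiagonal_eq_sum_range_succ
    (fun i j => coeff i (mk fun k => if k = 0 then 0 else v k) * coeff j (mk d))]
  have : Finset.Ico (0 + 1) (n + 1) = Finset.Icc 1 n := by ext; simp
  rw [Finset.range_eq_Ico, Finset.sum_eq_sum_Ico_succ_bot (by omega), this]
  simp only [coeff_mk, if_true, zero_mul, zero_add]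
  refine Finset.sum_congr rfl fun j hj => ?_
  rw [if_neg (by have := Finset.mem_Icc.mp hj; omega), mul_comm]

open PowerSeries in
lemma mk_doc_mul_mk (b : ℕ → ℝ) (hb : b 0 ≠ 0) : mk (doc b) * mk b = 1 := by
  ext n
  rw [mul_comm, coeff_mul, Finset.Nat.sum_antidiagonal_eq_sum_range_succ
    (fun i j => coeff i (mk b) * coeff j (mk (doc b)))]
  simp only [coeff_mk, coeff_one]
  cases n with
  | zero => simp [doc, hb]
  | succ n =>
    have h : doc b (n + 1) =
        -(1 / b 0) * ∑ s ∈ Finset.Icc 1 (n + 1), doc b (n + 1 - s) * b s := by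
      rw [doc, Finset.sum_attach (Finset.Icc 1 (n + 1)) fun s => doc b (n + 1 - s) * b s]
    rw [Finset.range_eq_Ico, Finset.sum_eq_sum_Ico_succ_bot (by omega), Nat.sub_zero, h]
    simp only [mul_comm (doc b _)]
    rw [← mul_assoc, show b 0 * -(1 / b 0) = -1 by field_simp]
    have : Finset.Ico (0 + 1) (n + 1 + 1) = Finset.Icc 1 (n + 1) := by ext; simp
    rw [this]
    simp

open PowerSeries in
lemma convolution_form_pos_of_mk_mul_mk_eq_one {c d : ℕ → ℝ} (hcd : mk c * mk d = 1) {m : ℕ}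
    (hc : ∀ v : ℕ → ℝ, (∃ ℓ ∈ Finset.Icc 1 m, v ℓ ≠ 0) →
        0 < ∑ ℓ ∈ Finset.Icc 1 m, v ℓ * ∑ j ∈ Finset.Icc 1 ℓ, c (ℓ - j) * v j)
    (v : ℕ → ℝ) (hv : ∃ ℓ ∈ Finset.Icc 1 m, v ℓ ≠ 0) :
    0 < ∑ ℓ ∈ Finset.Icc 1 m, v ℓ * ∑ j ∈ Finset.Icc 1 ℓ, d (ℓ - j) * v j := by
  set w : ℕ → ℝ := fun n => ∑ j ∈ Finset.Icc 1 n, d (n - j) * v j with hw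
  have hW : (mk fun k => if k = 0 then 0 else w k) =
      mk d * mk fun k => if k = 0 then 0 else v k := by
    ext n
    rw [coeff_mk_mul_mk_ite, coeff_mk]
    split_ifs with h
    · simp [h]
    · rfl
  have hinv : ∀ n ∈ Finset.Icc 1 m, ∑ j ∈ Finset.Icc 1 n, c (n - j) * w j = v n := by
    intro n hn
    have hn0 : n ≠ 0 := by have := Finset.mem_Icc.mp hn; omega
    rw [← coeff_mk_mul_mk_ite, hW, ← mul_assoc, hcd, one_mul, coeff_mk, if_neg hn0]
  have hpos := hc w (by
    by_contra! h
    obtain ⟨n, hn, hvn⟩ := hv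
    refine hvn ((hinv n hn).symm.trans (Finset.sum_eq_zero fun j hj => ?_))
    rw [h j (Finset.Icc_subset_Icc_right (Finset.mem_Icc.mp hn).2 hj), mul_zero])
  refine hpos.trans_eq (Finset.sum_congr rfl fun n hn => ?_)
  rw [hinv n hn, mul_comm]

theorem doc_positive_definite_iff (b : ℕ → ℝ) (hb : b 0 ≠ 0) (m : ℕ) (hm : 1 ≤ m) :
    (∀ v : ℕ → ℝ, (∃ ℓ ∈ Finset.Icc 1 m, v ℓ ≠ 0) →
        0 < ∑ ℓ ∈ Finset.Icc 1 m, v ℓ * ∑ j ∈ Finset.Icc 1 ℓ, b (ℓ - j) * v j) ↔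
    (∀ v : ℕ → ℝ, (∃ ℓ ∈ Finset.Icc 1 m, v ℓ ≠ 0) →
        0 < ∑ ℓ ∈ Finset.Icc 1 m, v ℓ * ∑ j ∈ Finset.Icc 1 ℓ, doc b (ℓ - j) * v j) := by
  have h := mk_doc_mul_mk b hb
  exact ⟨convolution_form_pos_of_mk_mul_mk_eq_one (by rw [mul_comm, h]),
    convolution_form_pos_of_mk_mul_mk_eq_one h⟩
end

section
/- Let B be a real m×m matrix and let m₁, m₂ > 0 be constants such that vᵀ(B + Bᵀ)v ≥ m₁·‖v‖² for all v ∈ ℝ^m and ‖Bv‖² ≤ m₂·‖v‖² for all v ∈ ℝ^m (where ‖·‖ is the Euclidean norm). Then B is invertible and vᵀ(B⁻¹ + (B⁻¹)ᵀ)v ≥ (m₁/m₂)·‖v‖² for all v ∈ ℝ^m. -/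
open Matrix

/-- The quadratic form of `A + Aᵀ` is twice that of `A`. -/
theorem dotProduct_add_transpose_mulVec {n R : Type*} [Fintype n] [CommRing R]
    (A : Matrix n n R) (v : n → R) :
    v ⬝ᵥ (A + Aᵀ).mulVec v = 2 * (v ⬝ᵥ A.mulVec v) := by
  rw [add_mulVec, dotProduct_add, mulVec_transpose, dotProduct_comm v (v ᵥ* A),
    ← dotProduct_mulVec, two_mul]

theorem inverse_symmetric_part_eigenvalue_bound (m : ℕ) (B : Matrix (Fin m) (Fin m) ℝ)
    (m1 m2 : ℝ) (hm1 : 0 < m1) (hm2 : 0 < m2)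
    (hlow : ∀ v : Fin m → ℝ, m1 * (v ⬝ᵥ v) ≤ v ⬝ᵥ (B + Bᵀ).mulVec v)
    (hup : ∀ v : Fin m → ℝ, (B.mulVec v) ⬝ᵥ (B.mulVec v) ≤ m2 * (v ⬝ᵥ v)) :
    IsUnit B ∧ ∀ v : Fin m → ℝ, m1 / m2 * (v ⬝ᵥ v) ≤ v ⬝ᵥ (B⁻¹ + (B⁻¹)ᵀ).mulVec v := by
  have hB : IsUnit B := by
    rw [← mulVec_injective_iff_isUnit]
    refine (injective_iff_map_eq_zero B.mulVecLin).2 fun v hv => ?_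
    rw [mulVecLin_apply] at hv
    have h := hlow v
    rw [dotProduct_add_transpose_mulVec, hv, dotProduct_zero, mul_zero] at h
    have h0 : 0 ≤ v ⬝ᵥ v := Finset.sum_nonneg fun i _ => mul_self_nonneg (v i)
    exact dotProduct_self_eq_zero.1 (by nlinarith)
  refine ⟨hB, fun v => ?_⟩
  obtain ⟨w, rfl⟩ := (mulVec_surjective_iff_isUnit.2 hB) v
  have hdet := (isUnit_iff_isUnit_det B).1 hB
  have h := hlow w
  rw [dotProduct_add_transpose_mulVec] at h ⊢
  rw [mulVec_mulVec, nonsing_inv_mul B hdet, one_mulVec, dotProduct_comm (B *ᵥ w) w]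
  calc m1 / m2 * (B *ᵥ w ⬝ᵥ B *ᵥ w) ≤ m1 / m2 * (m2 * (w ⬝ᵥ w)) := by
        gcongr
        exact hup w
    _ = m1 * (w ⬝ᵥ w) := by field_simp
    _ ≤ 2 * (w ⬝ᵥ B *ᵥ w) := h
end

section
/- Let (b_j)_{j≥0} be real kernels with b₀ ≠ 0, let (θ_j)_{j≥0} be the associated DOC kernels, and suppose there are constants m₁ > 0 and m₃ > 0 such that for every m ≥ 1 and all real v₁, …, v_m: 2·∑_{ℓ=1}^{m} v_ℓ · ∑_{j=1}^{ℓ} b_{ℓ−j} v_j ≥ m₁·∑_{ℓ=1}^{m} v_ℓ² and 2·∑_{ℓ=1}^{m} ∑_{j=1}^{ℓ} θ_{ℓ−j} v_j v_ℓ ≤ m₃·∑_{ℓ=1}^{m} v_ℓ². Then for every ε > 0, every m ≥ 1, and all real sequences v₁, …, v_m and w₁, …, w_m: ∑_{ℓ=1}^{m} ∑_{j=1}^{ℓ} θ_{ℓ−j} v_j w_ℓ ≤ ε·∑_{ℓ=1}^{m} v_ℓ² + (m₃/(4 m₁ ε))·∑_{ℓ=1}^{m} w_ℓ². -/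
theorem PowerSeries.coeff_mk_mul_mk_eq_sum_Icc_add {R : Type*} [CommSemiring R]
    (a v : ℕ → R) (n : ℕ) :
    PowerSeries.coeff n (PowerSeries.mk v * PowerSeries.mk a) =
      ∑ j ∈ Finset.Icc 1 n, a (n - j) * v j + a n * v 0 := by
  rw [PowerSeries.coeff_mul,
    Finset.Nat.sum_antidiagonal_eq_sum_range_succ_mk, Finset.range_eq_Ico,
    Finset.sum_eq_sum_Ico_succ_bot (Nat.succ_pos n), add_comm]
  simp only [PowerSeries.coeff_mk, mul_comm, Nat.sub_zero]
  rfl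

theorem mk_mul_mk_doc (b : ℕ → ℝ) (hb : b 0 ≠ 0) :
    PowerSeries.mk b * PowerSeries.mk (doc b) = 1 := by
  ext n
  rw [PowerSeries.coeff_mk_mul_mk_eq_sum_Icc_add, PowerSeries.coeff_one]
  cases n with
  | zero => simp [doc, hb]
  | succ k =>
    have h : doc b (k + 1) =
        -(1 / b 0) * ∑ s ∈ Finset.Icc 1 (k + 1), doc b (k + 1 - s) * b s := by
      rw [doc, Finset.sum_attach _ fun s => doc b (k + 1 - s) * b s]
    rw [h, if_neg k.succ_ne_zero]
    field_simp
    ring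

/-- Convolution with the kernels `b` inverts convolution with the DOC kernels of `b`. -/
theorem sum_mul_sum_doc_mul (b : ℕ → ℝ) (hb : b 0 ≠ 0) (v : ℕ → ℝ) {n : ℕ} (hn : 1 ≤ n) :
    ∑ j ∈ Finset.Icc 1 n, b (n - j) * ∑ i ∈ Finset.Icc 1 j, doc b (j - i) * v i = v n := by
  set u : ℕ → ℝ := fun j => ∑ i ∈ Finset.Icc 1 j, doc b (j - i) * v i with hu
  set v' : ℕ → ℝ := Function.update v 0 0 with hv'
  have h : PowerSeries.mk u = PowerSeries.mk v' * PowerSeries.mk (doc b) := by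
    ext k
    rw [PowerSeries.coeff_mk_mul_mk_eq_sum_Icc_add, PowerSeries.coeff_mk, hv',
      Function.update_self, mul_zero, add_zero]
    refine Finset.sum_congr rfl fun i hi => ?_
    rw [Function.update_of_ne (by have := (Finset.mem_Icc.mp hi).1; omega)]
  have h2 := PowerSeries.coeff_mk_mul_mk_eq_sum_Icc_add b u n
  rw [h, mul_assoc, mul_comm (PowerSeries.mk (doc b)), mk_mul_mk_doc b hb, mul_one,
    PowerSeries.coeff_mk, hv', Function.update_of_ne (by omega)] at h2
  rw [h2]
  simp [hu]

theorem doc_young_type_inequality_embedding (b : ℕ → ℝ) (hb : b 0 ≠ 0)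
    (m1 m3 : ℝ) (hm1 : 0 < m1) (hm3 : 0 < m3)
    (hpd : ∀ m : ℕ, 1 ≤ m → ∀ v : ℕ → ℝ,
      m1 * ∑ ℓ ∈ Finset.Icc 1 m, (v ℓ)^2 ≤
        2 * ∑ ℓ ∈ Finset.Icc 1 m, v ℓ * ∑ j ∈ Finset.Icc 1 ℓ, b (ℓ - j) * v j)
    (hub : ∀ m : ℕ, 1 ≤ m → ∀ v : ℕ → ℝ,
      2 * ∑ ℓ ∈ Finset.Icc 1 m, ∑ j ∈ Finset.Icc 1 ℓ, doc b (ℓ - j) * v j * v ℓ ≤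
        m3 * ∑ ℓ ∈ Finset.Icc 1 m, (v ℓ)^2)
    (ε : ℝ) (hε : 0 < ε) (m : ℕ) (hm : 1 ≤ m) (v w : ℕ → ℝ) :
    ∑ ℓ ∈ Finset.Icc 1 m, ∑ j ∈ Finset.Icc 1 ℓ, doc b (ℓ - j) * v j * w ℓ ≤
      ε * ∑ ℓ ∈ Finset.Icc 1 m, (v ℓ)^2
        + m3 / (4 * m1 * ε) * ∑ ℓ ∈ Finset.Icc 1 m, (w ℓ)^2 := by
  set u : ℕ → ℝ := fun ℓ => ∑ j ∈ Finset.Icc 1 ℓ, doc b (ℓ - j) * v j with hu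
  have hbu : ∑ ℓ ∈ Finset.Icc 1 m, u ℓ * ∑ j ∈ Finset.Icc 1 ℓ, b (ℓ - j) * u j =
      ∑ ℓ ∈ Finset.Icc 1 m, u ℓ * v ℓ :=
    Finset.sum_congr rfl fun ℓ hℓ => by
      rw [hu, sum_mul_sum_doc_mul b hb v (Finset.mem_Icc.mp hℓ).1]
  have h1 := hpd m hm u
  have h2 := hub m hm v
  simp only [← Finset.sum_mul] at h2 ⊢
  rw [hbu] at h1
  have huv : m1 * ∑ ℓ ∈ Finset.Icc 1 m, u ℓ ^ 2 ≤ m3 * ∑ ℓ ∈ Finset.Icc 1 m, v ℓ ^ 2 :=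
    h1.trans h2
  have hyoung : ∀ x y : ℝ, x * y ≤ ε * m1 / m3 * x ^ 2 + m3 / (4 * m1 * ε) * y ^ 2 := by
    intro x y
    have h : ε * m1 / m3 * x ^ 2 + m3 / (4 * m1 * ε) * y ^ 2 - x * y =
        (2 * m1 * ε * x - m3 * y) ^ 2 / (4 * m1 * ε * m3) := by
      field_simp
      ring
    have : 0 ≤ (2 * m1 * ε * x - m3 * y) ^ 2 / (4 * m1 * ε * m3) := by positivity
    linarith
  calc ∑ ℓ ∈ Finset.Icc 1 m, u ℓ * w ℓ
      ≤ ∑ ℓ ∈ Finset.Icc 1 m, (ε * m1 / m3 * u ℓ ^ 2 + m3 / (4 * m1 * ε) * w ℓ ^ 2) :=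
        Finset.sum_le_sum fun ℓ _ => hyoung _ _
    _ = ε / m3 * (m1 * ∑ ℓ ∈ Finset.Icc 1 m, u ℓ ^ 2)
          + m3 / (4 * m1 * ε) * ∑ ℓ ∈ Finset.Icc 1 m, w ℓ ^ 2 := by
        rw [Finset.sum_add_distrib, ← Finset.mul_sum, ← Finset.mul_sum]
        ring
    _ ≤ ε / m3 * (m3 * ∑ ℓ ∈ Finset.Icc 1 m, v ℓ ^ 2)
          + m3 / (4 * m1 * ε) * ∑ ℓ ∈ Finset.Icc 1 m, w ℓ ^ 2 := by gcongr
    _ = _ := by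
        field_simp
end
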